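/- arXiv:math/0112161 — 2 statements merged into one kernel-verified Lean document; each statement's English description precedes it below -/
import Mathlib

section
/- Let R = (E,φ) be a nonzero representation of a finite quiver Q on finite-dimensional complex inner product spaces. If the given inner products satisfy the (σ,τ)-vortex equations, then R is (σ,τ)-semistable: for every nonzero proper subrepresentation R' one has μ_{σ,τ}(R') ≤ μ_{σ,τ}(R). -/
open scoped InnerProductSpace

noncomputable section

variable {Q0 Q1 : Type} [DecidableEq Q0] [Fintype Q0] [Fintype Q1]
variable (t h : Q1 → Q0)
variable (E : Q0 → Type) [∀ v, NormedAddCommGroup (E v)]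
  [∀ v, InnerProductSpace ℂ (E v)] [∀ v, FiniteDimensional ℂ (E v)]
variable (φ : ∀ a, E (t a) →ₗ[ℂ] E (h a))

/-- The moment-map/vortex operator at a vertex `v`:
`∑_{a ∈ h⁻¹(v)} φ_a ∘ φ_a* − ∑_{a ∈ t⁻¹(v)} φ_a* ∘ φ_a`. -/
def vortexOp (v : Q0) : E v →ₗ[ℂ] E v :=
  (∑ a : Q1, if hav : h a = v then hav ▸ (φ a ∘ₗ LinearMap.adjoint (φ a)) else 0)
  - ∑ a : Q1, if hav : t a = v then hav ▸ (LinearMap.adjoint (φ a) ∘ₗ φ a) else 0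

/-- The (σ,τ)-vortex equations over a point (the curvature terms vanish). -/
def SatisfiesVortex (τ : Q0 → ℝ) : Prop :=
  ∀ v, vortexOp t h E φ v = (τ v : ℂ) • LinearMap.id

/-- A family of subspaces is a subrepresentation if it is preserved by all the maps `φ_a`. -/
def IsSubrep (U : ∀ v, Submodule ℂ (E v)) : Prop :=
  ∀ a, ∀ x ∈ U (t a), φ a x ∈ U (h a)

/-- The (σ,τ)-degree of a family of subspaces: `−∑_v τ_v dim_ℂ U_v`. -/
def degST (τ : Q0 → ℝ) (U : ∀ v, Submodule ℂ (E v)) : ℝ :=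
  - ∑ v, τ v * (Module.finrank ℂ (U v) : ℝ)

/-- The (σ,τ)-slope of a family of subspaces. -/
def slopeST (σ τ : Q0 → ℝ) (U : ∀ v, Submodule ℂ (E v)) : ℝ :=
  degST E τ U / ∑ v, σ v * (Module.finrank ℂ (U v) : ℝ)

/-- (σ,τ)-stability: every nonzero proper subrepresentation has strictly smaller slope. -/
def IsStable (σ τ : Q0 → ℝ) : Prop :=
  ∀ U : ∀ v, Submodule ℂ (E v), IsSubrep t h E φ U →
    (∃ v, U v ≠ ⊥) → (∃ v, U v ≠ ⊤) →
    slopeST E σ τ U < slopeST E σ τ (fun v => (⊤ : Submodule ℂ (E v)))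

open scoped ComplexOrder in
/-- If `f` maps `U` into `W`, then `tr (P_W f f*) - tr (P_U f* f)` is nonnegative, being the trace
of `A* A` for `A = P_W f (1 - P_U)`. -/
theorem trace_starProjection_comp_sub_nonneg {V V' : Type*}
    [NormedAddCommGroup V] [InnerProductSpace ℂ V] [FiniteDimensional ℂ V]
    [NormedAddCommGroup V'] [InnerProductSpace ℂ V'] [FiniteDimensional ℂ V']
    (f : V →ₗ[ℂ] V') (U : Submodule ℂ V) (W : Submodule ℂ V') (hf : ∀ x ∈ U, f x ∈ W) :
    0 ≤ LinearMap.trace ℂ V' (W.starProjection.toLinearMap ∘ₗ (f ∘ₗ LinearMap.adjoint f))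
      - LinearMap.trace ℂ V (U.starProjection.toLinearMap ∘ₗ (LinearMap.adjoint f ∘ₗ f)) := by
  set P : V →ₗ[ℂ] V := U.starProjection.toLinearMap
  set P' : V' →ₗ[ℂ] V' := W.starProjection.toLinearMap
  have hPP : P ∘ₗ P = P :=
    ContinuousLinearMap.IsIdempotentElem.toLinearMap U.isIdempotentElem_starProjection
  have hPP' : P' ∘ₗ P' = P' :=
    ContinuousLinearMap.IsIdempotentElem.toLinearMap W.isIdempotentElem_starProjection
  have hPa : LinearMap.adjoint P = P := U.starProjection_isSymmetric.adjoint_eq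
  have hPa' : LinearMap.adjoint P' = P' := W.starProjection_isSymmetric.adjoint_eq
  have hfP : P' ∘ₗ f ∘ₗ P = f ∘ₗ P := by
    ext x
    exact Submodule.starProjection_eq_self_iff.mpr (hf _ (U.starProjection_apply_mem x))
  have hQQ : (LinearMap.id - P) ∘ₗ (LinearMap.id - P) = LinearMap.id - P := by
    simp [LinearMap.sub_comp, LinearMap.comp_sub, hPP]
  have hpos := (LinearMap.isPositive_adjoint_comp_self
    (P' ∘ₗ f ∘ₗ (LinearMap.id - P))).trace_nonneg
  have hadj : LinearMap.adjoint (P' ∘ₗ f ∘ₗ (LinearMap.id - P)) =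
      (LinearMap.id - P) ∘ₗ LinearMap.adjoint f ∘ₗ P' := by
    simp [LinearMap.adjoint_comp, hPa, hPa', LinearMap.comp_assoc]
  have h₁ : LinearMap.trace ℂ V' (P' ∘ₗ (f ∘ₗ LinearMap.adjoint f)) =
      LinearMap.trace ℂ V (LinearMap.adjoint f ∘ₗ P' ∘ₗ f) := by
    rw [← LinearMap.comp_assoc, LinearMap.trace_comp_comm']
  have h₂ : LinearMap.trace ℂ V (P ∘ₗ (LinearMap.adjoint f ∘ₗ f)) =
      LinearMap.trace ℂ V (LinearMap.adjoint f ∘ₗ P' ∘ₗ f ∘ₗ P) := by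
    rw [LinearMap.trace_comp_comm', hfP, LinearMap.comp_assoc]
  have h₃ : (LinearMap.adjoint f ∘ₗ P') ∘ₗ (P' ∘ₗ f ∘ₗ (LinearMap.id - P)) ∘ₗ
      (LinearMap.id - P) =
      LinearMap.adjoint f ∘ₗ P' ∘ₗ f - LinearMap.adjoint f ∘ₗ P' ∘ₗ f ∘ₗ P := by
    have hPP'f : P' ∘ₗ P' ∘ₗ f = P' ∘ₗ f := by rw [← LinearMap.comp_assoc, hPP']
    simp only [LinearMap.comp_assoc, hQQ]
    simp only [LinearMap.comp_sub, LinearMap.comp_id, hPP'f, hfP]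
  rw [hadj, LinearMap.comp_assoc, LinearMap.trace_comp_comm', LinearMap.comp_assoc, h₃, map_sub] at hpos
  rwa [h₁, h₂]

/-- The vertexwise traces against the vortex operator, reorganized as a sum over arrows. -/
theorem sum_trace_comp_vortexOp (T : ∀ v, E v →ₗ[ℂ] E v) :
    ∑ v, LinearMap.trace ℂ (E v) (T v ∘ₗ vortexOp t h E φ v) =
      ∑ a, (LinearMap.trace ℂ (E (h a)) (T (h a) ∘ₗ (φ a ∘ₗ LinearMap.adjoint (φ a)))
        - LinearMap.trace ℂ (E (t a)) (T (t a) ∘ₗ (LinearMap.adjoint (φ a) ∘ₗ φ a))) := by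
  have key (u : Q0) (S : E u →ₗ[ℂ] E u) :
      ∑ v, LinearMap.trace ℂ (E v) (T v ∘ₗ (if huv : u = v then huv ▸ S else 0)) =
        LinearMap.trace ℂ (E u) (T u ∘ₗ S) := by
    rw [Finset.sum_eq_single u]
    · simp
    · intro v _ hv
      simp [hv.symm]
    · simp
  have comp_sum (v : Q0) (S : Q1 → (E v →ₗ[ℂ] E v)) : T v ∘ₗ ∑ a, S a = ∑ a, T v ∘ₗ S a :=
    Finset.mul_sum _ _ (T v)
  simp only [vortexOp, LinearMap.comp_sub, comp_sum, map_sub, map_sum,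
    Finset.sum_sub_distrib]
  congr 1
  · rw [Finset.sum_comm]
    exact Finset.sum_congr rfl fun a _ => key (h a) _
  · rw [Finset.sum_comm]
    exact Finset.sum_congr rfl fun a _ => key (t a) _

/-- Under the vortex equations, the degree of a family of subspaces is minus the total trace of
the orthogonal projections against the vortex operator. -/
theorem SatisfiesVortex.ofReal_degST {τ : Q0 → ℝ} (hvortex : SatisfiesVortex t h E φ τ)
    (U : ∀ v, Submodule ℂ (E v)) :
    ((degST E τ U : ℝ) : ℂ) = -∑ v, LinearMap.trace ℂ (E v)
      ((U v).starProjection.toLinearMap ∘ₗ vortexOp t h E φ v) := by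
  have htr (v : Q0) : LinearMap.trace ℂ (E v) (U v).starProjection.toLinearMap =
      (Module.finrank ℂ (U v) : ℂ) :=
    LinearMap.IsProj.trace ⟨(U v).starProjection_apply_mem,
      fun _ hx => Submodule.starProjection_eq_self_iff.mpr hx⟩
  simp [degST, hvortex _, LinearMap.comp_smul, htr]

theorem SatisfiesVortex.degST_top {τ : Q0 → ℝ} (hvortex : SatisfiesVortex t h E φ τ) :
    degST E τ (fun v => (⊤ : Submodule ℂ (E v))) = 0 := by
  rw [← Complex.ofReal_eq_zero, hvortex.ofReal_degST, sum_trace_comp_vortexOp, neg_eq_zero]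
  refine Finset.sum_eq_zero fun a _ => ?_
  simp only [Submodule.starProjection_top, ContinuousLinearMap.coe_id, LinearMap.id_comp]
  rw [LinearMap.trace_comp_comm', sub_self]

open scoped ComplexOrder in
theorem SatisfiesVortex.degST_nonpos {τ : Q0 → ℝ} (hvortex : SatisfiesVortex t h E φ τ)
    {U : ∀ v, Submodule ℂ (E v)} (hU : IsSubrep t h E φ U) : degST E τ U ≤ 0 := by
  rw [← Complex.real_le_real, hvortex.ofReal_degST, sum_trace_comp_vortexOp, Complex.ofReal_zero,
    neg_nonpos]
  exact Finset.sum_nonneg fun a _ => trace_starProjection_comp_sub_nonneg (φ a) _ _ (hU a)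

/-- A nonzero representation of a finite quiver whose inner products satisfy
the (σ,τ)-vortex equations is (σ,τ)-semistable: every nonzero proper subrepresentation
has slope at most the slope of the whole representation. -/
theorem statement2 (σ τ : Q0 → ℝ) (hσ : ∀ v, 0 < σ v)
    (hnz : ∃ v, Module.finrank ℂ (E v) ≠ 0)
    (hvortex : SatisfiesVortex t h E φ τ) :
    ∀ U : ∀ v, Submodule ℂ (E v), IsSubrep t h E φ U →
      (∃ v, U v ≠ ⊥) → (∃ v, U v ≠ ⊤) →
      slopeST E σ τ U ≤ slopeST E σ τ (fun v => (⊤ : Submodule ℂ (E v))) := by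
  intro U hU _ _
  rw [slopeST, slopeST, hvortex.degST_top, zero_div]
  exact div_nonpos_of_nonpos_of_nonneg (hvortex.degST_nonpos t h E φ hU)
    (Finset.sum_nonneg fun v _ => mul_nonneg (hσ v).le (Nat.cast_nonneg _))
end
end

section
/- Define Ψ : ℝ×ℝ → ℝ by Ψ(x,y) = (e^{y−x} − (y−x) − 1)/(y−x)² if x ≠ y, and Ψ(x,x) = 1/2. Let F : ℝ×ℝ → ℝ be a smooth non-negative function with compact support such that F(x,y)·(x−y) < 1 whenever x > y. Then there exists l₀ > 0 such that for every l ≥ l₀ and every (x,y) ∈ ℝ×ℝ one has F(x,y) ≤ l·Ψ(l·x, l·y). -/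
noncomputable section

/-- The function `Ψ` from the definition of the Donaldson lagrangian:
`Ψ(x,y) = (e^{y−x} − (y−x) − 1)/(y−x)²` for `x ≠ y`, extended by `1/2` on the diagonal. -/
def Psi (x y : ℝ) : ℝ :=
  if x = y then 1 / 2 else (Real.exp (y - x) - (y - x) - 1) / (y - x) ^ 2

/-- `Ψ` is bounded below by `1/4` on the region `x - y ≤ 2`. -/
theorem one_fourth_le_Psi {x y : ℝ} (h : x - y ≤ 2) : 1 / 4 ≤ Psi x y := by
  unfold Psi
  split_ifs with hxy
  · norm_num
  · have hpos : 0 < (y - x) ^ 2 := by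
      have : y - x ≠ 0 := sub_ne_zero.mpr (Ne.symm hxy)
      positivity
    rw [le_div_iff₀ hpos]
    have h1 := Real.add_one_le_exp ((y - x) / 2)
    have h2 : Real.exp (y - x) = Real.exp ((y - x) / 2) ^ 2 := by
      rw [← Real.exp_nat_mul]
      congr 1
      push_cast
      ring
    have h3 : ((y - x) / 2 + 1) ^ 2 ≤ Real.exp ((y - x) / 2) ^ 2 :=
      pow_le_pow_left₀ (by linarith) h1 2
    rw [h2]
    nlinarith

theorem sub_one_div_sq_le_Psi {x y : ℝ} (h : y < x) :
    (x - y - 1) / (x - y) ^ 2 ≤ Psi x y := by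
  rw [Psi, if_neg h.ne', ← neg_sub x y, neg_sq]
  refine div_le_div_of_nonneg_right ?_ (sq_nonneg _)
  linarith [Real.exp_pos (-(x - y))]

/-- A continuous compactly supported real function that is everywhere
less than a positive `a` is bounded above by some `c` with `0 ≤ c < a`. -/
theorem exists_upper_bound_lt {α : Type*} [TopologicalSpace α] {f : α → ℝ}
    (hf : Continuous f) (hs : HasCompactSupport f) {a : ℝ} (ha : 0 < a) (hlt : ∀ p, f p < a) :
    ∃ c, 0 ≤ c ∧ c < a ∧ ∀ p, f p ≤ c := by
  rcases isEmpty_or_nonempty α with hα | hα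
  · exact ⟨0, le_rfl, ha, fun p => hα.elim p⟩
  · obtain ⟨p, hp⟩ := hf.exists_forall_ge_of_hasCompactSupport hs
    exact ⟨max 0 (f p), le_max_left _ _, max_lt ha (hlt p), fun q => (hp q).trans (le_max_right _ _)⟩

/-- a smooth non-negative compactly supported function `F` on `ℝ×ℝ` with
`F(x,y)·(x−y) < 1` whenever `x > y` is eventually dominated by `l·Ψ(l·x, l·y)`:
there is `l₀ > 0` with `F(x,y) ≤ l·Ψ(l·x, l·y)` for all `l ≥ l₀` and all `(x,y)`. -/
theorem statement13 (F : ℝ × ℝ → ℝ)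
    (hsmooth : ContDiff ℝ (⊤ : ℕ∞) F) (hnonneg : ∀ p, 0 ≤ F p)
    (hsupp : HasCompactSupport F)
    (hdom : ∀ x y : ℝ, y < x → F (x, y) * (x - y) < 1) :
    ∃ l₀ : ℝ, 0 < l₀ ∧ ∀ l ≥ l₀, ∀ x y : ℝ, F (x, y) ≤ l * Psi (l * x) (l * y) := by
  have hcont : Continuous F := hsmooth.continuous
  obtain ⟨M, hM⟩ := hcont.bounded_above_of_compact_support hsupp
  have hFM : ∀ p, F p ≤ M := fun p => (le_abs_self _).trans (hM p)
  have hM0 : 0 ≤ M := (hnonneg 0).trans (hFM 0)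
  obtain ⟨c, -, hc1, hc⟩ := exists_upper_bound_lt (f := fun p : ℝ × ℝ => F p * (p.1 - p.2))
    (by fun_prop) hsupp.mul_right one_pos (by
      rintro ⟨x, y⟩
      rcases lt_or_ge y x with h | h
      · exact hdom x y h
      · exact (mul_nonpos_of_nonneg_of_nonpos (hnonneg _) (sub_nonpos.mpr h)).trans_lt one_pos)
  set K : ℝ := 1 / (1 - c) with hK
  have hK0 : 0 < K := one_div_pos.mpr (sub_pos.mpr hc1)
  have hKM : 0 ≤ K * M := by positivity
  refine ⟨4 * M + 2 * (K * M) + 1, by positivity, fun l hl x y => ?_⟩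
  have hl0 : 0 < l := by linarith
  rcases le_or_gt (l * x - l * y) 2 with h | h
  · have := mul_le_mul_of_nonneg_left (one_fourth_le_Psi h) hl0.le
    linarith [hFM (x, y)]
  · refine le_trans ?_ (mul_le_mul_of_nonneg_left
      (sub_one_div_sq_le_Psi (show l * y < l * x by linarith)) hl0.le)
    rw [← mul_sub] at h ⊢
    set s := l * (x - y) with hs
    rw [← mul_div_assoc, le_div_iff₀ (by positivity)]
    rcases le_or_gt K s with hKs | hKs
    · have h1 : 1 ≤ s * (1 - c) := by
        rwa [hK, div_le_iff₀ (sub_pos.mpr hc1)] at hKs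
      have h2 : F (x, y) * (x - y) * s ≤ c * s :=
        mul_le_mul_of_nonneg_right (hc (x, y)) (by linarith)
      calc F (x, y) * s ^ 2 = l * (F (x, y) * (x - y) * s) := by rw [hs]; ring
        _ ≤ l * (s - 1) := by gcongr; linarith
    · have h1 : F (x, y) * s ≤ M * K :=
        mul_le_mul (hFM _) hKs.le (by linarith) hM0
      calc F (x, y) * s ^ 2 = F (x, y) * s * s := by ring
        _ ≤ l / 2 * s := by gcongr; linarith
        _ ≤ l * (s - 1) := by nlinarith
end
end
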